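/- Let m ≥ 2 be an integer and n = 2^m. If C and C' are binary [n,k] codes (of the same dimension k) satisfying the conditions (C1) and (C2) with respect to positive integers a and a' respectively, and C and C' have the same minimum weight, then a = a' and A_i(C) = A_i(C') for all i; that is, the minimum weight determines the weight distribution. -/

import Mathlib

open Finset

/-- The (Hamming) weight of a vector over `ZMod 2`. -/
def wt {ι : Type*} [Fintype ι] (x : ι → ZMod 2) : ℕ :=
  (Finset.univ.filter fun i => x i ≠ 0).card

/-- The first order Reed–Muller code `RM(1,m)`: coordinates are indexed by the
points of `F_2^m`, and the codewords are the evaluation vectors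
`v ↦ a·v + b` for `a ∈ F_2^m`, `b ∈ F_2`. -/
def RM1 (m : ℕ) : Set ((Fin m → ZMod 2) → ZMod 2) :=
  {f | ∃ (a : Fin m → ZMod 2) (b : ZMod 2), f = fun v => (∑ i, a i * v i) + b}

/-- A binary `[2^m, k]` code `C` satisfies conditions (C1) and (C2) with respect to
a positive integer `a` with `0 < a < 2^m/2`:
(C1) the set of weights of codewords of `C` is exactly
`{0, 2^m/2 - a, 2^m/2, 2^m/2 + a, 2^m}`, and
(C2) `C` contains `RM(1,m)` as a subcode. -/
def SatCond (m k a : ℕ) (C : Submodule (ZMod 2) ((Fin m → ZMod 2) → ZMod 2)) : Prop :=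
  Module.finrank (ZMod 2) C = k ∧ 0 < a ∧ a < 2 ^ m / 2 ∧
  {w : ℕ | ∃ x ∈ C, wt x = w} =
    ({0, 2 ^ m / 2 - a, 2 ^ m / 2, 2 ^ m / 2 + a, 2 ^ m} : Set ℕ) ∧
  RM1 m ⊆ (C : Set ((Fin m → ZMod 2) → ZMod 2))

/-- `Ai C i` is the number `A_i(C)` of codewords of weight `i` in `C`. -/
noncomputable def Ai {ι : Type*} [Fintype ι] (C : Set (ι → ZMod 2)) (i : ℕ) : ℕ :=
  {x ∈ C | wt x = i}.ncard

/-- The minimum (nonzero) weight of a code. -/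
noncomputable def dmin {ι : Type*} [Fintype ι] (C : Set (ι → ZMod 2)) : ℕ :=
  sInf {w : ℕ | ∃ x ∈ C, x ≠ 0 ∧ wt x = w}

/-- Two binary codes of the same length are equivalent if one is obtained from
the other by a permutation of the coordinates. -/
def CodeEquiv {ι : Type*} [Fintype ι] (C C' : Set (ι → ZMod 2)) : Prop :=
  ∃ σ : Equiv.Perm ι, C' = (fun x => x ∘ σ) '' C

/-- The dual code of a binary code. -/
def dualCode {ι : Type*} [Fintype ι] (C : Submodule (ZMod 2) (ι → ZMod 2)) :
    Submodule (ZMod 2) (ι → ZMod 2) where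
  carrier := {x | ∀ y ∈ C, ∑ i, x i * y i = 0}
  add_mem' := by
    intro x₁ x₂ h₁ h₂ y hy
    simp only [Set.mem_setOf_eq] at h₁ h₂ ⊢
    simp only [Pi.add_apply, add_mul, Finset.sum_add_distrib, h₁ y hy, h₂ y hy, add_zero]
  zero_mem' := by
    intro y hy
    simp
  smul_mem' := by
    intro c x hx y hy
    simp only [Set.mem_setOf_eq] at hx ⊢
    simp only [Pi.smul_apply, smul_eq_mul, mul_assoc, ← Finset.mul_sum, hx y hy, mul_zero]

/-- The covering radius `ρ(C) = max_x min_{c ∈ C} wt (x - c)`. -/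
noncomputable def covRad {ι : Type*} [Fintype ι] (C : Set (ι → ZMod 2)) : ℕ :=
  sSup {r : ℕ | ∃ x : ι → ZMod 2, r = sInf {w : ℕ | ∃ c ∈ C, w = wt (x - c)}}

/-- A code of length `2^m` satisfying the conditions (C1) and (C2) is maximal if it is
not properly contained in any code of length `2^m` satisfying the conditions. -/
def MaximalSat (m : ℕ) (C : Submodule (ZMod 2) ((Fin m → ZMod 2) → ZMod 2)) : Prop :=
  (∃ k a, SatCond m k a C) ∧
  ∀ D : Submodule (ZMod 2) ((Fin m → ZMod 2) → ZMod 2),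
    (∃ k a, SatCond m k a D) → C ≤ D → D = C

/-- `P` has exactly `N` equivalence classes of codes. -/
def ExactlyNClasses {m : ℕ} (N : ℕ)
    (P : Submodule (ZMod 2) ((Fin m → ZMod 2) → ZMod 2) → Prop) : Prop :=
  ∃ f : Fin N → Submodule (ZMod 2) ((Fin m → ZMod 2) → ZMod 2),
    (∀ i, P (f i)) ∧
    (∀ i j, i ≠ j →
      ¬ CodeEquiv (↑(f i) : Set ((Fin m → ZMod 2) → ZMod 2)) (↑(f j))) ∧
    ∀ C, P C → ∃ i, CodeEquiv (↑C : Set ((Fin m → ZMod 2) → ZMod 2)) (↑(f i))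

/-- A weighing matrix of order `n` and weight `k`. -/
def IsWeighing (n k : ℕ) (W : Matrix (Fin n) (Fin n) ℤ) : Prop :=
  (∀ i j, W i j = 0 ∨ W i j = 1 ∨ W i j = -1) ∧
  W * W.transpose = (k : ℤ) • (1 : Matrix (Fin n) (Fin n) ℤ)

/-- A Hadamard matrix of order `n`. -/
def IsHadamard (n : ℕ) (H : Matrix (Fin n) (Fin n) ℤ) : Prop :=
  (∀ i j, H i j = 1 ∨ H i j = -1) ∧
  H * H.transpose = (n : ℤ) • (1 : Matrix (Fin n) (Fin n) ℤ)

/-- The sign character on `ZMod 2`. -/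
def sg (x : ZMod 2) : ℤ := if x = 0 then 1 else -1

lemma sg_add (x y : ZMod 2) : sg (x + y) = sg x * sg y := by
  revert x y; decide

lemma sum_sg {ι : Type*} [Fintype ι] (x : ι → ZMod 2) :
    ∑ v, sg (x v) = (Fintype.card ι : ℤ) - 2 * (wt x : ℤ) := by
  have h : ∀ v, sg (x v) = 1 - 2 * (if x v ≠ 0 then (1 : ℤ) else 0) := by
    intro v
    unfold sg
    by_cases hv : x v = 0 <;> simp [hv]
  simp_rw [h]
  rw [Finset.sum_sub_distrib, ← Finset.mul_sum, Finset.sum_boole]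
  simp [wt]

open Classical in
/-- The codewords, as a finset. -/
noncomputable def cw {m : ℕ} (C : Submodule (ZMod 2) ((Fin m → ZMod 2) → ZMod 2)) :
    Finset ((Fin m → ZMod 2) → ZMod 2) := Finset.univ.filter (fun x => x ∈ C)

lemma mem_cw {m : ℕ} (C : Submodule (ZMod 2) ((Fin m → ZMod 2) → ZMod 2)) (x) :
    x ∈ cw C ↔ x ∈ C := by simp [cw]

lemma Ai_eq {m : ℕ} (C : Submodule (ZMod 2) ((Fin m → ZMod 2) → ZMod 2)) (i : ℕ) :
    Ai (↑C : Set ((Fin m → ZMod 2) → ZMod 2)) i = ((cw C).filter (fun x => wt x = i)).card := by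
  unfold Ai
  rw [← Set.ncard_coe_finset]
  congr 1
  ext x
  simp [mem_cw]

lemma card_cw {m : ℕ} (C : Submodule (ZMod 2) ((Fin m → ZMod 2) → ZMod 2)) :
    (cw C).card = 2 ^ Module.finrank (ZMod 2) C := by
  classical
  have h := Module.card_eq_pow_finrank (K := ZMod 2) (V := C)
  rw [ZMod.card] at h
  rw [← h, cw, Fintype.card_subtype]

lemma orth {m : ℕ} (C : Submodule (ZMod 2) ((Fin m → ZMod 2) → ZMod 2))
    (hR : RM1 m ⊆ (C : Set ((Fin m → ZMod 2) → ZMod 2))) (u v : Fin m → ZMod 2) (huv : u ≠ v) :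
    ∑ x ∈ cw C, sg (x u) * sg (x v) = 0 := by
  classical
  obtain ⟨j, hj⟩ := Function.ne_iff.mp huv
  have hc : (fun v : Fin m → ZMod 2 => v j) ∈ C := by
    apply hR
    refine ⟨Pi.single j 1, 0, ?_⟩
    funext v
    simp [Pi.single_apply]
  set c : (Fin m → ZMod 2) → ZMod 2 := fun v => v j with hcdef
  have h1 : ∑ x ∈ cw C, sg (x u) * sg (x v) = ∑ x ∈ cw C, sg ((x + c) u) * sg ((x + c) v) := by
    symm
    refine Finset.sum_bij' (fun x _ => x + c) (fun x _ => x - c) ?_ ?_ ?_ ?_ ?_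
    · intro x hx
      rw [mem_cw] at *
      exact C.add_mem hx hc
    · intro x hx
      rw [mem_cw] at *
      exact C.sub_mem hx hc
    · intro x _; simp
    · intro x _; simp
    · intro x _; rfl
  have h2 : sg (c u) * sg (c v) = -1 := by
    have : ∀ p q : ZMod 2, p ≠ q → sg p * sg q = -1 := by decide
    exact this _ _ hj
  have h3 : ∑ x ∈ cw C, sg ((x + c) u) * sg ((x + c) v) = - ∑ x ∈ cw C, sg (x u) * sg (x v) := by
    rw [← Finset.sum_neg_distrib]
    refine Finset.sum_congr rfl fun x _ => ?_
    rw [Pi.add_apply, Pi.add_apply, sg_add, sg_add]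
    linear_combination (sg (x u) * sg (x v)) * h2
  linarith

lemma moment {m : ℕ} (C : Submodule (ZMod 2) ((Fin m → ZMod 2) → ZMod 2))
    (hR : RM1 m ⊆ (C : Set ((Fin m → ZMod 2) → ZMod 2))) :
    ∑ x ∈ cw C, ((2 : ℤ) ^ m - 2 * (wt x : ℤ)) ^ 2 = (2 : ℤ) ^ m * ((cw C).card : ℤ) := by
  classical
  have hcard : (Fintype.card (Fin m → ZMod 2) : ℤ) = 2 ^ m := by simp [ZMod.card]
  have h : ∀ x ∈ cw C, ((2 : ℤ) ^ m - 2 * (wt x : ℤ)) ^ 2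
      = ∑ u, ∑ v, sg (x u) * sg (x v) := by
    intro x _
    rw [← hcard, ← sum_sg, sq, Finset.sum_mul_sum]
  rw [Finset.sum_congr rfl h, Finset.sum_comm]
  have h2 : ∀ u : Fin m → ZMod 2,
      ∑ x ∈ cw C, ∑ v, sg (x u) * sg (x v) = ((cw C).card : ℤ) := by
    intro u
    rw [Finset.sum_comm, Finset.sum_eq_single u]
    · have : ∀ p : ZMod 2, sg p * sg p = 1 := by decide
      simp [this]
    · intro v _ hv
      exact orth C hR u v hv.symm
    · simp
  simp_rw [h2]
  rw [Finset.sum_const, Finset.card_univ, nsmul_eq_mul, hcard]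

lemma wt_zero_iff {ι : Type*} [Fintype ι] (x : ι → ZMod 2) : wt x = 0 ↔ x = 0 := by
  simp [wt, Finset.filter_eq_empty_iff, funext_iff]

lemma wt_compl {m : ℕ} (x : (Fin m → ZMod 2) → ZMod 2) : wt (x + 1) + wt x = 2 ^ m := by
  have h1 := sum_sg x
  have h2 := sum_sg (x + 1)
  have h3 : ∑ v, sg ((x + 1) v) = - ∑ v, sg (x v) := by
    rw [← Finset.sum_neg_distrib]
    refine Finset.sum_congr rfl fun v _ => ?_
    have : ∀ p : ZMod 2, sg (p + 1) = - sg p := by decide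
    exact this _
  have hcard : (Fintype.card (Fin m → ZMod 2) : ℤ) = 2 ^ m := by simp [ZMod.card]
  rw [hcard] at h1 h2
  zify
  linarith

lemma Ai_compl {m : ℕ} (C : Submodule (ZMod 2) ((Fin m → ZMod 2) → ZMod 2))
    (hR : RM1 m ⊆ (C : Set ((Fin m → ZMod 2) → ZMod 2))) (i j : ℕ) (hij : i + j = 2 ^ m) :
    ((cw C).filter (fun x => wt x = i)).card = ((cw C).filter (fun x => wt x = j)).card := by
  have hc : (1 : (Fin m → ZMod 2) → ZMod 2) ∈ C := by
    apply hR
    refine ⟨0, 1, ?_⟩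
    funext v
    simp
  refine Finset.card_bij' (fun x _ => x + 1) (fun x _ => x - 1) ?_ ?_ ?_ ?_
  · intro x hx
    rw [Finset.mem_filter, mem_cw] at *
    have := wt_compl x
    exact ⟨C.add_mem hx.1 hc, by omega⟩
  · intro x hx
    rw [Finset.mem_filter, mem_cw] at *
    have := wt_compl (x - 1)
    rw [sub_add_cancel] at this
    exact ⟨C.sub_mem hx.1 hc, by omega⟩
  · intro x _; simp
  · intro x _; simp

lemma Ai_zero {m : ℕ} (C : Submodule (ZMod 2) ((Fin m → ZMod 2) → ZMod 2)) :
    ((cw C).filter (fun x => wt x = 0)).card = 1 := by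
  rw [Finset.card_eq_one]
  refine ⟨0, ?_⟩
  ext x
  rw [Finset.mem_filter, mem_cw, wt_zero_iff, Finset.mem_singleton]
  constructor
  · exact fun h => h.2
  · rintro rfl; exact ⟨C.zero_mem, rfl⟩

lemma sum_wt {m k a h : ℕ} (hh : 2 ^ m = 2 * h)
    (C : Submodule (ZMod 2) ((Fin m → ZMod 2) → ZMod 2))
    (hC : SatCond m k a C) (g : ℕ → ℤ) :
    ∑ x ∈ cw C, g (wt x) = (Ai (C : Set ((Fin m → ZMod 2) → ZMod 2)) 0 : ℤ) * g 0 + Ai (C : Set ((Fin m → ZMod 2) → ZMod 2)) (h - a) * g (h - a)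
      + Ai (C : Set ((Fin m → ZMod 2) → ZMod 2)) h * g h + Ai (C : Set ((Fin m → ZMod 2) → ZMod 2)) (h + a) * g (h + a)
      + Ai (C : Set ((Fin m → ZMod 2) → ZMod 2)) (2 * h) * g (2 * h) := by
  classical
  obtain ⟨-, ha, hlt, hW, -⟩ := hC
  have hdiv : 2 ^ m / 2 = h := by omega
  rw [hdiv] at hlt hW
  rw [hh] at hW
  have hmap : ∀ x ∈ cw C, wt x ∈ ({0, h - a, h, h + a, 2 * h} : Finset ℕ) := by
    intro x hx
    have : wt x ∈ {w : ℕ | ∃ x ∈ C, wt x = w} := ⟨x, (mem_cw C x).1 hx, rfl⟩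
    rw [hW] at this
    simpa using this
  rw [← Finset.sum_fiberwise_of_maps_to hmap]
  have key : ∀ i, ∑ x ∈ cw C with wt x = i, g (wt x) = (Ai (C : Set ((Fin m → ZMod 2) → ZMod 2)) i : ℤ) * g i := by
    intro i
    rw [Ai_eq, ← nsmul_eq_mul, ← Finset.sum_const]
    refine Finset.sum_congr rfl fun x hx => ?_
    rw [(Finset.mem_filter.1 hx).2]
  simp_rw [key]
  rw [Finset.sum_insert, Finset.sum_insert, Finset.sum_insert, Finset.sum_insert,
    Finset.sum_singleton]
  · ring
  all_goals simp only [Finset.mem_insert, Finset.mem_singleton]; omega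

lemma dmin_eq {m k a h : ℕ} (hh : 2 ^ m = 2 * h)
    (C : Submodule (ZMod 2) ((Fin m → ZMod 2) → ZMod 2))
    (hC : SatCond m k a C) : dmin (C : Set ((Fin m → ZMod 2) → ZMod 2)) = h - a := by
  obtain ⟨-, ha, hlt, hW, -⟩ := hC
  have hdiv : 2 ^ m / 2 = h := by omega
  rw [hdiv] at hlt hW
  rw [hh] at hW
  have h1 : h - a ∈ {w : ℕ | ∃ x ∈ (C : Set ((Fin m → ZMod 2) → ZMod 2)), x ≠ 0 ∧ wt x = w} := by
    have : h - a ∈ {w : ℕ | ∃ x ∈ C, wt x = w} := by rw [hW]; simp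
    obtain ⟨x, hx, hw⟩ := this
    refine ⟨x, hx, ?_, hw⟩
    intro h0
    rw [← wt_zero_iff] at h0
    omega
  apply le_antisymm
  · exact Nat.sInf_le h1
  · refine le_csInf ⟨_, h1⟩ ?_
    rintro w ⟨x, hx, hx0, rfl⟩
    have : wt x ∈ {w : ℕ | ∃ x ∈ C, wt x = w} := ⟨x, hx, rfl⟩
    rw [hW] at this
    have h0 : wt x ≠ 0 := fun h => hx0 ((wt_zero_iff x).1 h)
    simp only [Set.mem_insert_iff, Set.mem_singleton_iff] at this
    omega

/-- All values of the weight distribution. -/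
lemma wdist {m k a h : ℕ} (hh : 2 ^ m = 2 * h)
    (C : Submodule (ZMod 2) ((Fin m → ZMod 2) → ZMod 2)) (hC : SatCond m k a C) :
    Ai (C : Set ((Fin m → ZMod 2) → ZMod 2)) 0 = 1 ∧ Ai (C : Set ((Fin m → ZMod 2) → ZMod 2)) (2 * h) = 1 ∧
    Ai (C : Set ((Fin m → ZMod 2) → ZMod 2)) (h + a) = Ai (C : Set ((Fin m → ZMod 2) → ZMod 2)) (h - a) ∧
    (8 * (h : ℤ) ^ 2 + 8 * (a : ℤ) ^ 2 * Ai (C : Set ((Fin m → ZMod 2) → ZMod 2)) (h - a) = 2 * h * 2 ^ k) ∧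
    ((2 : ℤ) + 2 * Ai (C : Set ((Fin m → ZMod 2) → ZMod 2)) (h - a) + Ai (C : Set ((Fin m → ZMod 2) → ZMod 2)) h = 2 ^ k) ∧
    ∀ i, i ≠ 0 → i ≠ h - a → i ≠ h → i ≠ h + a → i ≠ 2 * h → Ai (C : Set ((Fin m → ZMod 2) → ZMod 2)) i = 0 := by
  have hsum := sum_wt hh C hC
  obtain ⟨hk, ha, hlt, hW, hR⟩ := hC
  have hdiv : 2 ^ m / 2 = h := by omega
  rw [hdiv] at hlt hW
  rw [hh] at hW
  have e0 : Ai (C : Set ((Fin m → ZMod 2) → ZMod 2)) 0 = 1 := by rw [Ai_eq, Ai_zero]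
  have e1 : Ai (C : Set ((Fin m → ZMod 2) → ZMod 2)) (2 * h) = 1 := by
    rw [Ai_eq, Ai_compl C hR _ 0 (by omega), Ai_zero]
  have e2 : Ai (C : Set ((Fin m → ZMod 2) → ZMod 2)) (h + a) = Ai (C : Set ((Fin m → ZMod 2) → ZMod 2)) (h - a) := by
    rw [Ai_eq, Ai_eq, Ai_compl C hR _ (h - a) (by omega)]
  have hcard : ((cw C).card : ℤ) = 2 ^ k := by rw [card_cw, hk]; push_cast; rfl
  have hhz : (2 : ℤ) ^ m = 2 * h := by exact_mod_cast hh
  have hs : ((h - a : ℕ) : ℤ) = (h : ℤ) - a := by push_cast [hlt.le]; ring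
  refine ⟨e0, e1, e2, ?_, ?_, ?_⟩
  · have h1 := moment C hR
    have h2 := hsum (fun w => ((2 : ℤ) ^ m - 2 * (w : ℤ)) ^ 2)
    rw [e0, e1, e2] at h2
    simp only [hhz, hs, hcard] at h1 h2
    rw [h1] at h2
    push_cast at h2
    linear_combination -h2
  · have h2 := hsum (fun _ => 1)
    rw [e0, e1, e2] at h2
    simp only [Finset.sum_const, nsmul_eq_mul, mul_one, hcard] at h2
    push_cast at h2
    linear_combination -h2
  · intro i i0 i1 i2 i3 i4
    rw [Ai_eq, Finset.card_eq_zero, Finset.filter_eq_empty_iff]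
    intro x hx hw
    have : wt x ∈ {w : ℕ | ∃ x ∈ C, wt x = w} := ⟨x, (mem_cw C x).1 hx, rfl⟩
    rw [hW, hw] at this
    simp only [Set.mem_insert_iff, Set.mem_singleton_iff] at this
    omega

/-- for codes of the same dimension satisfying (C1) and (C2), the
minimum weight determines the weight distribution. -/
theorem stmt6 (m k a a' : ℕ) (hm : 2 ≤ m)
    (C C' : Submodule (ZMod 2) ((Fin m → ZMod 2) → ZMod 2))
    (hC : SatCond m k a C) (hC' : SatCond m k a' C')
    (hd : dmin (↑C : Set ((Fin m → ZMod 2) → ZMod 2)) = dmin (↑C' : Set ((Fin m → ZMod 2) → ZMod 2))) :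
    a = a' ∧ ∀ i : ℕ, Ai (↑C : Set ((Fin m → ZMod 2) → ZMod 2)) i = Ai (↑C' : Set ((Fin m → ZMod 2) → ZMod 2)) i := by
  obtain ⟨h, hh⟩ : ∃ h, 2 ^ m = 2 * h := ⟨2 ^ (m - 1), by
    rw [← pow_succ']; congr 1; omega⟩
  have hdiv : 2 ^ m / 2 = h := by omega
  have ha := hC.2.1
  have hl := hC.2.2.1
  have hl' := hC'.2.2.1
  rw [hdiv] at hl hl'
  rw [dmin_eq hh C hC, dmin_eq hh C' hC'] at hd
  have haa : a = a' := by omega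
  subst haa
  refine ⟨rfl, ?_⟩
  obtain ⟨p0, p1, p2, p3, p4, p5⟩ := wdist hh C hC
  obtain ⟨q0, q1, q2, q3, q4, q5⟩ := wdist hh C' hC'
  have haz : (8 * (a : ℤ) ^ 2) ≠ 0 := by positivity
  have r1 : (Ai (C : Set ((Fin m → ZMod 2) → ZMod 2)) (h - a) : ℤ) = Ai (C' : Set ((Fin m → ZMod 2) → ZMod 2)) (h - a) := by
    apply mul_left_cancel₀ haz
    linarith
  have r2 : (Ai (C : Set ((Fin m → ZMod 2) → ZMod 2)) h : ℤ) = Ai (C' : Set ((Fin m → ZMod 2) → ZMod 2)) h := by linarith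
  norm_cast at r1 r2
  intro i
  by_cases i0 : i = 0
  · rw [i0, p0, q0]
  by_cases i1 : i = h - a
  · rw [i1, r1]
  by_cases i2 : i = h
  · rw [i2, r2]
  by_cases i3 : i = h + a
  · rw [i3, p2, q2, r1]
  by_cases i4 : i = 2 * h
  · rw [i4, p1, q1]
  rw [p5 i i0 i1 i2 i3 i4, q5 i i0 i1 i2 i3 i4]
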